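/- arXiv:2004.00458 — 2 statements merged into one kernel-verified Lean document; each statement's English description precedes it below -/
import Mathlib

section
/- Let Ψ be a Polish space equipped with its Borel σ-algebra, (Ω,ℱ,ℙ) a probability space, and (X_n)_{n∈ℕ} a sequence of measurable maps X_n : Ω → Ψ. Then X_n converges in probability to some measurable map X : Ω → Ψ if and only if the following holds: for each pair of subsequences (X_{n_ℓ})_ℓ and (X_{m_ℓ})_ℓ there exists a further subsequence (k ↦ ℓ_k) such that the joint laws of the pairs v_k = (X_{n_{ℓ_k}}, X_{m_{ℓ_k}}) converge weakly, as probability measures on Ψ × Ψ, to a probability measure ν with ν({(x,y) ∈ Ψ × Ψ : x = y}) = 1. -/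
open MeasureTheory Filter Topology

section CauchyInMeasure

variable {Ω Ψ : Type*} [MeasurableSpace Ω] {μ : Measure Ω} [MetricSpace Ψ]

/-- The bounded continuous function `(x, y) ↦ min 1 (dist x y / ε)`. -/
noncomputable def truncatedDist (Ψ : Type*) [MetricSpace Ψ] (ε : ℝ) (hε : 0 < ε) :
    BoundedContinuousFunction (Ψ × Ψ) ℝ :=
  BoundedContinuousFunction.ofNormedAddCommGroup
    (fun p : Ψ × Ψ => min 1 (dist p.1 p.2 / ε)) (by fun_prop) 1 (fun p => by
      have h : 0 ≤ dist p.1 p.2 / ε := by positivity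
      rw [Real.norm_of_nonneg (le_min zero_le_one h)]
      exact min_le_left _ _)

lemma truncatedDist_apply (ε : ℝ) (hε : 0 < ε) (p : Ψ × Ψ) :
    truncatedDist Ψ ε hε p = min 1 (dist p.1 p.2 / ε) := rfl

lemma truncatedDist_nonneg (ε : ℝ) (hε : 0 < ε) (p : Ψ × Ψ) :
    0 ≤ truncatedDist Ψ ε hε p :=
  le_min zero_le_one (by positivity)

lemma integral_truncatedDist_eq_zero [MeasurableSpace Ψ] {ν : Measure (Ψ × Ψ)}
    (hν : ∀ᵐ p ∂ν, p.1 = p.2) (ε : ℝ) (hε : 0 < ε) :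
    ∫ p, truncatedDist Ψ ε hε p ∂ν = 0 := by
  refine integral_eq_zero_of_ae ?_
  filter_upwards [hν] with p hp
  simp [truncatedDist_apply, hp]

variable [MeasurableSpace Ψ] [BorelSpace Ψ]

/-- A sequence that is Cauchy in measure has an almost everywhere convergent subsequence. -/
lemma exists_subseq_tendsto_ae_of_cauchy_in_measure [CompleteSpace Ψ] {X : ℕ → Ω → Ψ}
    (hX : ∀ n, Measurable (X n))
    (h : ∀ ε : ℝ, 0 < ε → Tendsto (fun p : ℕ × ℕ => μ {ω | ε ≤ dist (X p.1 ω) (X p.2 ω)})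
      (atTop ×ˢ atTop) (𝓝 0)) :
    ∃ φ : ℕ → ℕ, StrictMono φ ∧ ∃ Y : Ω → Ψ, Measurable Y ∧
      ∀ᵐ ω ∂μ, Tendsto (fun k => X (φ k) ω) atTop (𝓝 (Y ω)) := by
  have hev : ∀ n : ℕ, ∀ᶠ k in atTop, ∀ m ≥ k,
      μ {ω | (1 / 2 : ℝ) ^ n ≤ dist (X k ω) (X m ω)} ≤ 2⁻¹ ^ n := by
    intro n
    have h1 := (h ((1 / 2) ^ n) (by positivity)).eventually_le_const
      (show (0 : ENNReal) < 2⁻¹ ^ n from ENNReal.pow_pos (by simp) n)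
    rw [prod_atTop_atTop_eq, eventually_atTop] at h1
    obtain ⟨⟨a, b⟩, hab⟩ := h1
    filter_upwards [eventually_ge_atTop (max a b)] with k hk m hm
    exact hab (k, m) ⟨(le_max_left _ _).trans hk, ((le_max_right _ _).trans hk).trans hm⟩
  obtain ⟨φ, hφ, hle⟩ := extraction_forall_of_eventually hev
  have hsum : ∑' n, μ {ω | (1 / 2 : ℝ) ^ n ≤ dist (X (φ n) ω) (X (φ (n + 1)) ω)} ≠ ⊤ := by
    refine ne_top_of_le_ne_top ?_
      (ENNReal.tsum_le_tsum fun n => hle n (φ (n + 1)) (hφ n.lt_succ_self).le)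
    rw [ENNReal.tsum_geometric]
    simp
  have hlim : ∀ᵐ ω ∂μ, ∃ y, Tendsto (fun k => X (φ k) ω) atTop (𝓝 y) := by
    filter_upwards [ae_eventually_notMem hsum] with ω hω
    refine cauchySeq_tendsto_of_complete (cauchySeq_of_summable_dist ?_)
    refine Summable.of_norm_bounded_eventually_nat summable_geometric_two ?_
    filter_upwards [hω] with n hn
    rw [Real.norm_of_nonneg dist_nonneg]
    exact (not_le.mp hn).le
  obtain ⟨Y, hY, hYlim⟩ :=
    measurable_limit_of_tendsto_metrizable_ae (fun n => (hX (φ n)).aemeasurable) hlim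
  exact ⟨φ, hφ, Y, hY, hYlim⟩

variable [SecondCountableTopology Ψ]

/-- Markov's inequality for the truncated distance. -/
lemma measure_le_dist_le_integral_truncatedDist [IsFiniteMeasure μ] {U V : Ω → Ψ}
    (hU : Measurable U) (hV : Measurable V) (ε : ℝ) (hε : 0 < ε) :
    μ {ω | ε ≤ dist (U ω) (V ω)} ≤
      ENNReal.ofReal (∫ ω, truncatedDist Ψ ε hε (U ω, V ω) ∂μ) := by
  have hint : Integrable (fun ω => truncatedDist Ψ ε hε (U ω, V ω)) μ :=
    .of_bound ((truncatedDist Ψ ε hε).continuous.measurable.comp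
      (hU.prodMk hV)).aestronglyMeasurable _
      (Eventually.of_forall fun _ => (truncatedDist Ψ ε hε).norm_coe_le_norm _)
  have h := mul_meas_ge_le_integral_of_nonneg
    (Eventually.of_forall fun ω => truncatedDist_nonneg ε hε (U ω, V ω)) hint 1
  have hset : {ω | ε ≤ dist (U ω) (V ω)} = {ω | 1 ≤ truncatedDist Ψ ε hε (U ω, V ω)} := by
    ext ω
    simp [truncatedDist_apply, one_le_div hε]
  rw [one_mul, ← hset] at h
  rw [← ofReal_measureReal]
  exact ENNReal.ofReal_le_ofReal h

/-- A sequence that is Cauchy in measure converges in measure. -/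
lemma exists_tendstoInMeasure_of_cauchy_in_measure [CompleteSpace Ψ] [IsFiniteMeasure μ]
    {X : ℕ → Ω → Ψ} (hX : ∀ n, Measurable (X n))
    (h : ∀ ε : ℝ, 0 < ε → Tendsto (fun p : ℕ × ℕ => μ {ω | ε ≤ dist (X p.1 ω) (X p.2 ω)})
      (atTop ×ˢ atTop) (𝓝 0)) :
    ∃ Y : Ω → Ψ, Measurable Y ∧ TendstoInMeasure μ X atTop Y := by
  obtain ⟨φ, hφ, Y, hY, hlim⟩ := exists_subseq_tendsto_ae_of_cauchy_in_measure hX h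
  refine ⟨Y, hY, tendstoInMeasure_iff_dist.mpr fun ε hε => ?_⟩
  have hsub := tendstoInMeasure_iff_dist.mp (tendstoInMeasure_of_tendsto_ae
    (fun n => (hX (φ n)).aestronglyMeasurable) hlim) (ε / 2) (half_pos hε)
  have hcauchy := (h (ε / 2) (half_pos hε)).comp (tendsto_id.prodMk hφ.tendsto_atTop)
  refine tendsto_of_tendsto_of_tendsto_of_le_of_le tendsto_const_nhds
    (by simpa using hcauchy.add hsub) (fun _ => zero_le) fun n => ?_
  refine (measure_mono fun ω hω => ?_).trans (measure_union_le _ _)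
  by_contra hc
  simp only [Set.mem_union, Set.mem_ofPred_eq, not_or, not_le] at hc hω
  linarith [dist_triangle (X n ω) (X (φ n) ω) (Y ω), hc.1, hc.2]

/-- For pairs of subsequences of a sequence converging in measure, the joint laws converge along
a further subsequence to the law of the limit on the diagonal. -/
lemma exists_subseq_tendsto_integral_pair [IsFiniteMeasure μ] {X : ℕ → Ω → Ψ}
    {Y : Ω → Ψ} (hX : ∀ n, Measurable (X n)) (h : TendstoInMeasure μ X atTop Y)
    {nsub msub : ℕ → ℕ} (hn : StrictMono nsub) (hm : StrictMono msub) :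
    ∃ φ : ℕ → ℕ, StrictMono φ ∧ ∀ f : BoundedContinuousFunction (Ψ × Ψ) ℝ,
      Tendsto (fun k => ∫ ω, f (X (nsub (φ k)) ω, X (msub (φ k)) ω) ∂μ)
        atTop (𝓝 (∫ ω, f (Y ω, Y ω) ∂μ)) := by
  obtain ⟨φ, hφ, h₁⟩ := (h.comp hn.tendsto_atTop).exists_seq_tendsto_ae
  obtain ⟨ψ, hψ, h₂⟩ :=
    (h.comp (hm.comp hφ).tendsto_atTop).exists_seq_tendsto_ae
  refine ⟨φ ∘ ψ, hφ.comp hψ, fun f => ?_⟩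
  refine tendsto_integral_of_dominated_convergence (fun _ => ‖f‖)
    (fun k => (f.continuous.measurable.comp ((hX _).prodMk (hX _))).aestronglyMeasurable)
    (integrable_const _) (fun k => Eventually.of_forall fun ω => f.norm_coe_le_norm _) ?_
  filter_upwards [h₁, h₂] with ω hω₁ hω₂
  exact (f.continuous.tendsto _).comp
    ((hω₁.comp hψ.tendsto_atTop).prodMk_nhds hω₂)

end CauchyInMeasure

/-- **Gyöngy–Krylov characterization of convergence in probability.**
Let `Ψ` be a Polish space with its Borel σ-algebra, and `(Xₙ)` a sequence of `Ψ`-valued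
random elements on a probability space `(Ω, ℱ, ℙ)`. Then `Xₙ` converges in probability
to some random element iff for each pair of subsequences `(X_{nℓ}), (X_{mℓ})` there is a
further subsequence along which the joint laws of the pairs converge weakly to a
probability measure `ν` on `Ψ × Ψ` supported on the diagonal. -/
theorem gyongy_krylov
    {Ψ : Type*} [MetricSpace Ψ] [TopologicalSpace.SeparableSpace Ψ] [CompleteSpace Ψ]
    [MeasurableSpace Ψ] [BorelSpace Ψ]
    {Ω : Type*} [MeasurableSpace Ω] (ℙ : Measure Ω) [IsProbabilityMeasure ℙ]
    (X : ℕ → Ω → Ψ) (hX : ∀ n, Measurable (X n)) :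
    (∃ Y : Ω → Ψ, Measurable Y ∧
        ∀ ε : ℝ, 0 < ε →
          Tendsto (fun n => ℙ {ω | ε < dist (X n ω) (Y ω)}) atTop (𝓝 0))
    ↔
    (∀ nsub msub : ℕ → ℕ, StrictMono nsub → StrictMono msub →
      ∃ φ : ℕ → ℕ, StrictMono φ ∧
        ∃ ν : Measure (Ψ × Ψ), IsProbabilityMeasure ν ∧
          ν {p : Ψ × Ψ | p.1 = p.2} = 1 ∧
          ∀ f : BoundedContinuousFunction (Ψ × Ψ) ℝ,
            Tendsto (fun k => ∫ ω, f (X (nsub (φ k)) ω, X (msub (φ k)) ω) ∂ℙ)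
              atTop (𝓝 (∫ p, f p ∂ν))) := by
  have := UniformSpace.secondCountable_of_separable Ψ
  constructor
  · rintro ⟨Y, hY, hlim⟩ nsub msub hn hm
    have hmeas : TendstoInMeasure ℙ X atTop Y := by
      refine tendstoInMeasure_iff_dist.mpr fun ε hε => ?_
      refine tendsto_of_tendsto_of_tendsto_of_le_of_le tendsto_const_nhds
        (hlim (ε / 2) (half_pos hε)) (fun _ => zero_le)
        fun n => measure_mono fun ω hω => (half_lt_self hε).trans_le hω
    obtain ⟨φ, hφ, hφlim⟩ := exists_subseq_tendsto_integral_pair hX hmeas hn hm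
    have hYY : Measurable fun ω => (Y ω, Y ω) := hY.prodMk hY
    refine ⟨φ, hφ, ℙ.map fun ω => (Y ω, Y ω),
      Measure.isProbabilityMeasure_map hYY.aemeasurable, ?_, fun f => ?_⟩
    · rw [Measure.map_apply hYY (measurableSet_eq_fun measurable_fst measurable_snd)]
      simp
    · rw [integral_map hYY.aemeasurable f.continuous.measurable.aestronglyMeasurable]
      exact hφlim f
  · intro h
    have hcauchy : ∀ ε : ℝ, 0 < ε →
        Tendsto (fun p : ℕ × ℕ => ℙ {ω | ε ≤ dist (X p.1 ω) (X p.2 ω)})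
          (atTop ×ˢ atTop) (𝓝 0) := by
      intro ε hε
      refine tendsto_of_subseq_tendsto fun s hs => ?_
      rw [tendsto_prod_iff'] at hs
      obtain ⟨α, hα, hα'⟩ := strictMono_subseq_of_tendsto_atTop hs.1
      obtain ⟨β, hβ, hβ'⟩ :=
        strictMono_subseq_of_tendsto_atTop (hs.2.comp hα.tendsto_atTop)
      obtain ⟨φ, -, ν, hν, hdiag, hlim⟩ := h _ _ (hα'.comp hβ) hβ'
      have hae : ∀ᵐ p ∂ν, p.1 = p.2 :=
        (mem_ae_iff_prob_eq_one
          (measurableSet_eq_fun measurable_fst measurable_snd)).mpr hdiag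
      have h0 := hlim (truncatedDist Ψ ε hε)
      rw [integral_truncatedDist_eq_zero hae] at h0
      refine ⟨α ∘ β ∘ φ, tendsto_of_tendsto_of_tendsto_of_le_of_le tendsto_const_nhds
        (by simpa using ENNReal.tendsto_ofReal h0) (fun _ => zero_le) fun k => ?_⟩
      exact measure_le_dist_le_integral_truncatedDist (hX _) (hX _) ε hε
    obtain ⟨Y, hY, hlim⟩ := exists_tendstoInMeasure_of_cauchy_in_measure hX hcauchy
    refine ⟨Y, hY, fun ε hε => ?_⟩
    exact tendsto_of_tendsto_of_tendsto_of_le_of_le tendsto_const_nhds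
      (tendstoInMeasure_iff_dist.mp hlim ε hε) (fun _ => zero_le)
      fun n => measure_mono fun ω (hω : ε < _) => hω.le
end

section
/- Let T > 0, C ≥ 0, let a : [0,T] → [0,∞) be measurable with ∫₀^T a(s)² ds < ∞, and let u : [0,T] → [0,∞) be measurable and bounded. Assume that for every t ∈ [0,T]: u(t) ≤ C ∫₀ᵗ (t−s)^{−1/2} a(s) u(s) ds. Then u(t) = 0 for every t ∈ [0,T]. -/
open MeasureTheory intervalIntegral
open scoped ENNReal

/-- The one-sided power kernel `x ↦ x ^ (-γ)` on `(0, ∞)`, extended by zero. -/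
noncomputable def powerKernel (γ x : ℝ) : ℝ≥0∞ :=
  (Set.Ioi (0 : ℝ)).indicator (fun y => ENNReal.ofReal (y ^ (-γ))) x

lemma powerKernel_of_pos {γ x : ℝ} (hx : 0 < x) :
    powerKernel γ x = ENNReal.ofReal (x ^ (-γ)) :=
  Set.indicator_of_mem (Set.mem_Ioi.2 hx) _

lemma powerKernel_of_nonpos {γ x : ℝ} (hx : x ≤ 0) : powerKernel γ x = 0 :=
  Set.indicator_of_notMem (by simpa using hx) _

@[fun_prop]
lemma measurable_powerKernel (γ : ℝ) : Measurable (powerKernel γ) := by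
  unfold powerKernel
  exact Measurable.indicator (by fun_prop) measurableSet_Ioi

lemma powerKernel_mul_self (γ x : ℝ) :
    powerKernel γ x * powerKernel γ x = powerKernel (2 * γ) x := by
  rcases le_or_gt x 0 with hx | hx
  · simp [powerKernel_of_nonpos hx]
  · rw [powerKernel_of_pos hx, powerKernel_of_pos hx, ← ENNReal.ofReal_mul (by positivity),
      ← Real.rpow_add hx]
    ring_nf

lemma powerKernel_le {γ d x : ℝ} (hγ : 0 ≤ γ) (hd : 0 < d) (hx : d ≤ x) :
    powerKernel γ x ≤ ENNReal.ofReal (d ^ (-γ)) := by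
  rw [powerKernel_of_pos (hd.trans_le hx)]
  exact ENNReal.ofReal_le_ofReal (Real.rpow_le_rpow_of_nonpos hd hx (by linarith))

lemma powerKernel_half_mul_le {s r t : ℝ} (hsr : s < r) :
    powerKernel (1 / 2) (t - r) * powerKernel (1 / 2) (t - s) ≤
      powerKernel (2 / 3) (t - r) * powerKernel (1 / 3) (r - s) := by
  rcases le_or_gt (t - r) 0 with h | h
  · simp [powerKernel_of_nonpos h]
  · have hrs : 0 < r - s := by linarith
    have hts : 0 < t - s := by linarith
    rw [powerKernel_of_pos h, powerKernel_of_pos h, powerKernel_of_pos hrs,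
      powerKernel_of_pos hts, ← ENNReal.ofReal_mul (by positivity),
      ← ENNReal.ofReal_mul (by positivity)]
    apply ENNReal.ofReal_le_ofReal
    have e1 : (t - s) ^ (-(1 / 2 : ℝ)) = (t - s) ^ (-(1 / 6 : ℝ)) * (t - s) ^ (-(1 / 3 : ℝ)) := by
      rw [← Real.rpow_add hts]; norm_num
    have e2 : (t - r) ^ (-(2 / 3 : ℝ)) = (t - r) ^ (-(1 / 2 : ℝ)) * (t - r) ^ (-(1 / 6 : ℝ)) := by
      rw [← Real.rpow_add h]; norm_num
    rw [e1, e2, mul_assoc]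
    gcongr ?_ * (?_ * ?_)
    · exact Real.rpow_le_rpow_of_nonpos h (by linarith) (by norm_num)
    · exact Real.rpow_le_rpow_of_nonpos hrs (by linarith) (by norm_num)

lemma lintegral_Iic_powerKernel {d : ℝ} (hd : 0 ≤ d) :
    ∫⁻ y in Set.Iic d, powerKernel (2 / 3) y = ENNReal.ofReal (3 * d ^ (1 / 3 : ℝ)) := by
  have hint : IntervalIntegrable (fun y : ℝ => y ^ (-(2 / 3) : ℝ)) volume 0 d :=
    intervalIntegral.intervalIntegrable_rpow' (by norm_num)
  have h1 : ∫⁻ y in Set.Iic d, powerKernel (2 / 3) y =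
      ∫⁻ y in Set.Ioc 0 d, ENNReal.ofReal (y ^ (-(2 / 3) : ℝ)) := by
    unfold powerKernel
    rw [setLIntegral_indicator measurableSet_Ioi, Set.Ioi_inter_Iic]
  rw [h1, ← ofReal_integral_eq_lintegral_ofReal]
  · rw [← intervalIntegral.integral_of_le hd, integral_rpow (Or.inl (by norm_num))]
    congr 1
    norm_num
    ring
  · exact (intervalIntegrable_iff_integrableOn_Ioc_of_le hd).1 hint
  · exact (ae_restrict_mem measurableSet_Ioc).mono fun y hy => Real.rpow_nonneg hy.1.le _

lemma powerKernel_mul_le_add {d y z : ℝ} (hd : 0 < d) (h : y + z = 2 * d) :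
    powerKernel (2 / 3) y * powerKernel (2 / 3) z ≤
      ENNReal.ofReal (d ^ (-(2 / 3) : ℝ)) *
        ((Set.Iic d).indicator (powerKernel (2 / 3)) y +
          (Set.Iic d).indicator (powerKernel (2 / 3)) z) := by
  rcases le_total y d with hy | hy
  · rw [Set.indicator_of_mem (Set.mem_Iic.2 hy), mul_comm]
    exact mul_le_mul' (powerKernel_le (by norm_num) hd (by linarith)) le_self_add
  · rw [Set.indicator_of_mem (s := Set.Iic d) (a := z) (Set.mem_Iic.2 (by linarith))]
    exact mul_le_mul' (powerKernel_le (by norm_num) hd hy) le_add_self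

lemma lintegral_powerKernel_mul_le (s x : ℝ) :
    ∫⁻ t, powerKernel (2 / 3) (x - t) * powerKernel (2 / 3) (t - s) ≤
      12 * powerKernel (1 / 3) (x - s) := by
  rcases le_or_gt (x - s) 0 with h | h
  · have : ∀ t, powerKernel (2 / 3) (x - t) * powerKernel (2 / 3) (t - s) = 0 := fun t => by
      rcases le_total x t with ht | ht
      · simp [powerKernel_of_nonpos (sub_nonpos.2 ht)]
      · simp [powerKernel_of_nonpos (show t - s ≤ 0 by linarith)]
    simp [this]
  · obtain ⟨d, hd, hxs⟩ : ∃ d, 0 < d ∧ x - s = 2 * d := ⟨(x - s) / 2, by linarith, by ring⟩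
    have hm : Measurable ((Set.Iic d).indicator (powerKernel (2 / 3))) :=
      (measurable_powerKernel _).indicator measurableSet_Iic
    calc
      _ ≤ ∫⁻ t, ENNReal.ofReal (d ^ (-(2 / 3) : ℝ)) *
          ((Set.Iic d).indicator (powerKernel (2 / 3)) (x - t) +
            (Set.Iic d).indicator (powerKernel (2 / 3)) (t - s)) :=
        lintegral_mono fun t => powerKernel_mul_le_add hd (by linarith)
      _ = ENNReal.ofReal (d ^ (-(2 / 3) : ℝ)) *
          (ENNReal.ofReal (3 * d ^ (1 / 3 : ℝ)) + ENNReal.ofReal (3 * d ^ (1 / 3 : ℝ))) := by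
        rw [lintegral_const_mul _ (by fun_prop), lintegral_add_left (by fun_prop),
          lintegral_sub_left_eq_self, lintegral_sub_right_eq_self,
          lintegral_indicator measurableSet_Iic, lintegral_Iic_powerKernel hd.le]
      _ ≤ 12 * powerKernel (1 / 3) (x - s) := by
        rw [powerKernel_of_pos h, hxs, ← ENNReal.ofReal_add (by positivity) (by positivity),
          ← ENNReal.ofReal_mul (by positivity), ← ENNReal.ofReal_ofNat 12,
          ← ENNReal.ofReal_mul (by positivity)]
        apply ENNReal.ofReal_le_ofReal
        have e1 : d ^ (-(2 / 3) : ℝ) * d ^ (1 / 3 : ℝ) = d ^ (-(1 / 3) : ℝ) := by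
          rw [← Real.rpow_add hd]; norm_num
        have e2 : (1 / 2 : ℝ) ≤ 2 ^ (-(1 / 3) : ℝ) := by
          rw [one_div, ← Real.rpow_neg_one]
          exact Real.rpow_le_rpow_of_exponent_le (by norm_num) (by norm_num)
        rw [Real.mul_rpow (by norm_num) hd.le]
        have : 0 ≤ d ^ (-(1 / 3) : ℝ) := by positivity
        nlinarith

lemma lintegral_powerKernel_sub_mul_le {w f : ℝ → ℝ≥0∞} (hw : Measurable w) (hf : Measurable f)
    (x : ℝ) :
    ∫⁻ s, powerKernel (1 / 3) (x - s) * (w s * f s) ≤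
      (∫⁻ s, w s ^ 2) ^ (1 / 2 : ℝ) *
        (∫⁻ s, powerKernel (2 / 3) (x - s) * f s ^ 2) ^ (1 / 2 : ℝ) := by
  have := ENNReal.lintegral_mul_le_Lp_mul_Lq volume Real.HolderConjugate.two_two
    (f := w) (g := fun s => powerKernel (1 / 3) (x - s) * f s) hw.aemeasurable
    (by fun_prop)
  convert this using 3 with s
  · simp only [Pi.mul_apply]; ring
  · simp
  · refine lintegral_congr fun s => ?_
    rw [ENNReal.rpow_two, mul_pow, sq (powerKernel _ _), powerKernel_mul_self]
    norm_num

lemma lintegral_sq_le_two_mul {w : ℝ → ℝ≥0∞} (hw : Measurable w) (t : ℝ) :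
    (∫⁻ s, powerKernel (1 / 2) (t - s) * w s) ^ 2 ≤
      2 * ∫⁻ r, ∫⁻ s, powerKernel (2 / 3) (t - r) * powerKernel (1 / 3) (r - s) * (w r * w s) := by
  have hswap : ∫⁻ r, ∫⁻ s, powerKernel (2 / 3) (t - s) * powerKernel (1 / 3) (s - r) *
        (w r * w s) =
      ∫⁻ r, ∫⁻ s, powerKernel (2 / 3) (t - r) * powerKernel (1 / 3) (r - s) * (w r * w s) := by
    rw [lintegral_lintegral_swap (by fun_prop)]
    simp only [mul_comm (w _) (w _)]
  calc
    _ = ∫⁻ r, ∫⁻ s, powerKernel (1 / 2) (t - r) * powerKernel (1 / 2) (t - s) * (w r * w s) := by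
      rw [sq, ← lintegral_mul_const _ (by fun_prop)]
      refine lintegral_congr fun r => ?_
      rw [← lintegral_const_mul _ (by fun_prop)]
      refine lintegral_congr fun s => ?_
      ring
    _ ≤ ∫⁻ r, ∫⁻ s, (powerKernel (2 / 3) (t - r) * powerKernel (1 / 3) (r - s) * (w r * w s) +
          powerKernel (2 / 3) (t - s) * powerKernel (1 / 3) (s - r) * (w r * w s)) := by
      refine lintegral_mono fun r => lintegral_mono_ae ?_
      filter_upwards [compl_mem_ae_iff.2 (measure_singleton (μ := volume) r)] with s hs
      rcases lt_or_gt_of_ne (show s ≠ r from hs) with h | h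
      · exact le_add_right (mul_le_mul_left (powerKernel_half_mul_le h) _)
      · rw [mul_comm (powerKernel (1 / 2) _)]
        exact le_add_left (mul_le_mul_left (powerKernel_half_mul_le h) _)
    _ = _ := by
      rw [two_mul]
      nth_rewrite 2 [← hswap]
      rw [← lintegral_add_left (by fun_prop)]
      refine lintegral_congr fun r => ?_
      rw [← lintegral_add_left (by fun_prop)]

/-- Contraction estimate for the half-order fractional integral with a square-integrable
coefficient, in the norm `(⨆ x, ∫ t < x, (x - t) ^ (-2/3) * f t ^ 2) ^ (1/2)`. -/
lemma iSup_lintegral_powerKernel_le {w f : ℝ → ℝ≥0∞} (hw : Measurable w) (hf : Measurable f)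
    (h : ∀ t, f t ≤ ∫⁻ s, powerKernel (1 / 2) (t - s) * (w s * f s)) :
    (⨆ x, ∫⁻ t, powerKernel (2 / 3) (x - t) * f t ^ 2) ≤
      24 * (∫⁻ s, w s ^ 2) * ⨆ x, ∫⁻ t, powerKernel (2 / 3) (x - t) * f t ^ 2 := by
  set S := ⨆ x, ∫⁻ t, powerKernel (2 / 3) (x - t) * f t ^ 2
  set A := ∫⁻ s, w s ^ 2
  have hL : ∀ x, ∫⁻ s, powerKernel (1 / 3) (x - s) * (w s * f s) ≤
      A ^ (1 / 2 : ℝ) * S ^ (1 / 2 : ℝ) := fun x =>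
    (lintegral_powerKernel_sub_mul_le hw hf x).trans <| by
      gcongr
      exact le_iSup (fun x => ∫⁻ t, powerKernel (2 / 3) (x - t) * f t ^ 2) x
  set L := A ^ (1 / 2 : ℝ) * S ^ (1 / 2 : ℝ)
  have hLL : L * L = A * S := by
    rw [mul_mul_mul_comm, ← ENNReal.rpow_add_of_nonneg _ _ (by norm_num) (by norm_num),
      ← ENNReal.rpow_add_of_nonneg _ _ (by norm_num) (by norm_num)]
    norm_num
  set v : ℝ → ℝ≥0∞ := fun s => w s * f s
  have hvm : Measurable v := hw.mul hf
  refine iSup_le fun x => ?_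
  calc
    _ ≤ ∫⁻ t, powerKernel (2 / 3) (x - t) * (2 * ∫⁻ r, ∫⁻ s,
          powerKernel (2 / 3) (t - r) * powerKernel (1 / 3) (r - s) * (v r * v s)) := by
      refine lintegral_mono fun t => ?_
      gcongr
      exact (pow_le_pow_left' (h t) 2).trans (lintegral_sq_le_two_mul hvm t)
    _ = 2 * ∫⁻ t, ∫⁻ r, (powerKernel (2 / 3) (x - t) * powerKernel (2 / 3) (t - r)) *
          (v r * ∫⁻ s, powerKernel (1 / 3) (r - s) * v s) := by
      rw [← lintegral_const_mul _ (by fun_prop)]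
      refine lintegral_congr fun t => ?_
      rw [mul_left_comm, ← lintegral_const_mul _ (by fun_prop)]
      congr 1
      refine lintegral_congr fun r => ?_
      rw [← lintegral_const_mul _ (by fun_prop), ← lintegral_const_mul _ (by fun_prop),
        ← lintegral_const_mul _ (by fun_prop)]
      refine lintegral_congr fun s => ?_
      ring
    _ = 2 * ∫⁻ r, (∫⁻ t, powerKernel (2 / 3) (x - t) * powerKernel (2 / 3) (t - r)) *
          (v r * ∫⁻ s, powerKernel (1 / 3) (r - s) * v s) := by
      rw [lintegral_lintegral_swap (by fun_prop)]
      congr 1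
      refine lintegral_congr fun r => ?_
      rw [lintegral_mul_const _ (by fun_prop)]
    _ ≤ 2 * ∫⁻ r, (12 * powerKernel (1 / 3) (x - r)) * (v r * L) := by
      gcongr with r
      · exact lintegral_powerKernel_mul_le r x
      · exact hL r
    _ = 24 * L * ∫⁻ r, powerKernel (1 / 3) (x - r) * v r := by
      rw [← lintegral_const_mul _ (by fun_prop), ← lintegral_const_mul _ (by fun_prop)]
      refine lintegral_congr fun r => ?_
      ring
    _ ≤ 24 * L * L := by
      gcongr
      exact hL x
    _ = 24 * A * S := by rw [mul_assoc, hLL, mul_assoc]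

lemma iSup_lintegral_powerKernel_lt_top {f : ℝ → ℝ≥0∞} {K : Set ℝ}
    (hK : volume K ≠ ∞) {M : ℝ≥0∞} (hM : M ≠ ∞) (hfM : ∀ t, f t ≤ K.indicator (fun _ => M) t) :
    (⨆ x, ∫⁻ t, powerKernel (2 / 3) (x - t) * f t ^ 2) < ∞ := by
  have hKm : MeasurableSet (toMeasurable volume K) := measurableSet_toMeasurable _ _
  have hm : Measurable ((Set.Iic (1 : ℝ)).indicator (powerKernel (2 / 3))) :=
    (measurable_powerKernel _).indicator measurableSet_Iic
  refine (iSup_le fun x => ?_).trans_lt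
    (show M ^ 2 * (ENNReal.ofReal (3 * (1 : ℝ) ^ (1 / 3 : ℝ)) + volume K) < ∞ by finiteness)
  calc
    _ ≤ ∫⁻ t, M ^ 2 * ((Set.Iic 1).indicator (powerKernel (2 / 3)) (x - t) +
          (toMeasurable volume K).indicator 1 t) := by
      refine lintegral_mono fun t => ?_
      by_cases ht : t ∈ K
      · have h1 : f t ≤ M := by simpa [ht] using hfM t
        rw [mul_comm]
        refine mul_le_mul' (pow_le_pow_left' h1 2) ?_
        rw [Set.indicator_of_mem (subset_toMeasurable _ _ ht)]
        rcases le_total (x - t) 1 with h | h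
        · rw [Set.indicator_of_mem (Set.mem_Iic.2 h)]
          exact le_self_add
        · refine le_add_left ((powerKernel_le (by norm_num) one_pos h).trans ?_)
          simp
      · have h0 : f t = 0 := by simpa [ht] using hfM t
        simp [h0]
    _ = _ := by
      rw [lintegral_const_mul _ (by measurability), lintegral_add_left (by fun_prop),
        lintegral_sub_left_eq_self, lintegral_indicator measurableSet_Iic,
        lintegral_Iic_powerKernel zero_le_one, lintegral_indicator_one hKm,
        measure_toMeasurable]

/-- Uniqueness for the weakly singular Volterra inequality with small coefficient. -/
lemma eq_zero_of_le_lintegral_powerKernel {w f : ℝ → ℝ≥0∞} (hw : Measurable w)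
    (hf : Measurable f) {K : Set ℝ} (hK : volume K ≠ ∞) {M : ℝ≥0∞} (hM : M ≠ ∞)
    (hfM : ∀ t, f t ≤ K.indicator (fun _ => M) t)
    (hsmall : 24 * ∫⁻ s, w s ^ 2 < 1)
    (h : ∀ t, f t ≤ ∫⁻ s, powerKernel (1 / 2) (t - s) * (w s * f s)) (t : ℝ) : f t = 0 := by
  have hle := iSup_lintegral_powerKernel_le hw hf h
  have hfin := iSup_lintegral_powerKernel_lt_top hK hM hfM
  set S := ⨆ x, ∫⁻ t, powerKernel (2 / 3) (x - t) * f t ^ 2 with hS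
  have hS0 : S = 0 := by
    by_contra h0
    refine hle.not_gt ?_
    simpa using ENNReal.mul_lt_mul_left h0 hfin.ne hsmall
  have h0 : ∫⁻ s, powerKernel (2 / 3) (t - s) * f s ^ 2 = 0 := by
    have := le_iSup (fun x => ∫⁻ t, powerKernel (2 / 3) (x - t) * f t ^ 2) t
    rw [← hS, hS0] at this
    simpa using this
  rw [lintegral_eq_zero_iff (by fun_prop)] at h0
  refine le_antisymm ((h t).trans_eq ?_) zero_le
  rw [lintegral_eq_zero_iff (by fun_prop)]
  filter_upwards [h0] with s hs
  rcases le_or_gt (t - s) 0 with hts | hts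
  · simp [powerKernel_of_nonpos hts]
  · have hp : powerKernel (2 / 3) (t - s) ≠ 0 := by
      rw [powerKernel_of_pos hts]
      simpa using Real.rpow_pos_of_pos hts _
    have : f s = 0 := by simpa [hp] using hs
    simp [this]

lemma enorm_intervalIntegral_le_lintegral_powerKernel (C t : ℝ) (ht : 0 ≤ t) (a u : ℝ → ℝ) :
    ‖C * ∫ s in (0 : ℝ)..t, (t - s) ^ (-(1 : ℝ) / 2) * a s * u s‖ₑ ≤
      ∫⁻ s in Set.Ioc 0 t, powerKernel (1 / 2) (t - s) * (‖C * a s‖ₑ * ‖u s‖ₑ) := by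
  rw [← intervalIntegral.integral_const_mul, intervalIntegral.integral_of_le ht]
  refine (enorm_integral_le_lintegral_enorm _).trans (lintegral_mono_ae ?_)
  filter_upwards [ae_restrict_mem measurableSet_Ioc,
    ae_restrict_of_ae (compl_mem_ae_iff.2 (measure_singleton (μ := volume) t))] with s hs hst
  have hts : 0 < t - s := sub_pos.2 (lt_of_le_of_ne hs.2 hst)
  rw [powerKernel_of_pos hts, ← Real.enorm_of_nonneg (by positivity), ← enorm_mul, ← enorm_mul]
  refine le_of_eq (congrArg _ ?_)
  rw [neg_div]
  ring

/-- Gronwall-type lemma with the weakly singular kernel `(t-s)^{-1/2}` and a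
square-integrable nonnegative coefficient `a`: if a bounded, nonnegative, measurable `u`
on `[0,T]` satisfies `u(t) ≤ C ∫₀ᵗ (t-s)^{-1/2} a(s) u(s) ds` for all `t ∈ [0,T]`, then
`u ≡ 0` on `[0,T]`. -/
theorem singular_gronwall
    (T C : ℝ) (hT : 0 < T) (hC : 0 ≤ C)
    (a u : ℝ → ℝ)
    (ha_meas : Measurable a)
    (ha_nonneg : ∀ s ∈ Set.Icc (0 : ℝ) T, 0 ≤ a s)
    (ha_sq : IntegrableOn (fun s => a s ^ 2) (Set.Icc (0 : ℝ) T) volume)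
    (hu_meas : Measurable u)
    (hu_nonneg : ∀ t ∈ Set.Icc (0 : ℝ) T, 0 ≤ u t)
    (hu_bdd : ∃ B : ℝ, ∀ t ∈ Set.Icc (0 : ℝ) T, u t ≤ B)
    (h : ∀ t ∈ Set.Icc (0 : ℝ) T,
      u t ≤ C * ∫ s in (0 : ℝ)..t, (t - s) ^ (-(1 : ℝ) / 2) * a s * u s) :
    ∀ t ∈ Set.Icc (0 : ℝ) T, u t = 0 := by
  obtain ⟨B, hB⟩ := hu_bdd
  have hfin : ∫⁻ s in Set.Icc 0 T, ‖C * a s‖ₑ ^ 2 ≠ ∞ := by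
    have := (ha_sq.const_mul (C ^ 2)).2
    rw [hasFiniteIntegral_iff_enorm] at this
    simpa only [← mul_pow, enorm_pow] using this.ne
  obtain ⟨δ, hδ, hsmall⟩ := exists_pos_setLIntegral_lt_of_measure_lt hfin
    (ε := 1 / 24) (by simp)
  obtain ⟨η, hη, hηδ⟩ : ∃ η : ℝ, 0 < η ∧ ENNReal.ofReal η < δ := by
    obtain ⟨q, hq, hqδ⟩ := ENNReal.lt_iff_exists_nnreal_btwn.1 hδ
    exact ⟨q, by simpa using hq, by simpa using hqδ⟩
  have key : ∀ n : ℕ, ∀ t ∈ Set.Icc 0 T, t ≤ n * η → u t = 0 := by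
    intro n
    induction n with
    | zero =>
      intro t ht ht0
      obtain rfl : t = 0 := le_antisymm (by simpa using ht0) ht.1
      exact le_antisymm (by simpa using h 0 ht) (hu_nonneg 0 ht)
    | succ n ih =>
      intro t ht htn
      set J : Set ℝ := Set.Icc 0 T ∩ Set.Iic ((n + 1 : ℕ) * η)
      have hJm : MeasurableSet J := measurableSet_Icc.inter measurableSet_Iic
      set I : Set ℝ := Set.Ioc (n * η) ((n + 1 : ℕ) * η) with hI
      have hIT : MeasurableSet (I ∩ Set.Icc 0 T) := measurableSet_Ioc.inter measurableSet_Icc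
      have hvol : volume I < δ := by
        rw [hI, Real.volume_Ioc]
        convert hηδ using 2
        push_cast
        ring
      have hf0 : J.indicator (fun s => ‖u s‖ₑ) t = 0 := by
        refine eq_zero_of_le_lintegral_powerKernel
          (w := (I ∩ Set.Icc 0 T).indicator fun s => ‖C * a s‖ₑ) (K := Set.Icc 0 T)
          (M := ENNReal.ofReal B)
          (Measurable.indicator (by fun_prop) hIT) (Measurable.indicator (by fun_prop) hJm)
          (by simp) (by simp) (fun s => ?_) ?_ (fun s => ?_) t
        · by_cases hs : s ∈ J
          · rw [Set.indicator_of_mem hs, Set.indicator_of_mem hs.1,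
              Real.enorm_of_nonneg (hu_nonneg s hs.1)]
            exact ENNReal.ofReal_le_ofReal (hB s hs.1)
          · simp [hs]
        · have hpow : ∀ s, (I ∩ Set.Icc 0 T).indicator (fun s => ‖C * a s‖ₑ) s ^ 2 =
              (I ∩ Set.Icc 0 T).indicator (fun s => ‖C * a s‖ₑ ^ 2) s := fun s => by
            by_cases hs : s ∈ I ∩ Set.Icc 0 T <;> simp [hs]
          simp only [hpow]
          rw [lintegral_indicator hIT, ← Measure.restrict_restrict measurableSet_Ioc, mul_comm]
          exact (ENNReal.lt_div_iff_mul_lt (by simp) (by simp)).1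
            (hsmall I ((Measure.restrict_apply_le _ _).trans_lt hvol))
        · by_cases hs : s ∈ J
          · rw [Set.indicator_of_mem hs]
            have hus : ‖u s‖ₑ ≤ _ := (Real.enorm_of_nonneg (hu_nonneg s hs.1)).trans_le
              ((ENNReal.ofReal_le_ofReal (h s hs.1)).trans (Real.ofReal_le_enorm _))
            refine hus.trans ((enorm_intervalIntegral_le_lintegral_powerKernel C s hs.1.1 a u).trans
              ?_)
            rw [← lintegral_indicator measurableSet_Ioc]
            refine lintegral_mono fun r => ?_
            by_cases hr : r ∈ Set.Ioc 0 s
            · rw [Set.indicator_of_mem hr]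
              have hrT : r ∈ Set.Icc 0 T := ⟨hr.1.le, hr.2.trans hs.1.2⟩
              have hrn : r ≤ (n + 1 : ℕ) * η := hr.2.trans hs.2
              rcases le_or_gt r (n * η) with hrI | hrI
              · simp [ih r hrT hrI]
              · rw [Set.indicator_of_mem (show r ∈ I ∩ Set.Icc 0 T from ⟨⟨hrI, hrn⟩, hrT⟩),
                  Set.indicator_of_mem (show r ∈ J from ⟨hrT, hrn⟩)]
            · simp [hr]
          · simp [hs]
      rw [Set.indicator_of_mem (show t ∈ J from ⟨ht, htn⟩)] at hf0
      simpa using hf0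
  intro t ht
  obtain ⟨n, hn⟩ := exists_nat_ge (t / η)
  exact key n t ht ((div_le_iff₀ hη).1 hn)
end
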